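/- arXiv:2208.08397 — 2 statements merged into one kernel-verified Lean document; each statement's English description precedes it below -/
import Mathlib

section
/- Let d ∈ ℕ be even, let W assign a nonnegative real weight W_{i,j} to each unordered pair {i,j} of distinct elements of Fin d, and let P ∈ ℝ with P > Σ_{i<j} W_{i,j}. Define Q(x) = Σ_{i<j} W_{i,j} x_{i,j} + P · Σ_{i=1}^{d} (1 − Σ_{j ≠ i} x_{i,j})² for binary assignments x with x_{i,j} ∈ {0,1} and x_{i,j} = x_{j,i}. Then the minimum of Q over all binary assignments equals the minimum, over all perfect pairings A of Fin d, of Σ_{{i,j} ∈ A} W_{i,j}. -/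
/-- A binary assignment on unordered pairs of distinct elements of `Fin d`:
each pair `{i,j}` with `i ≠ j` receives a value in `{0,1} ⊆ ℝ`. -/
def IsBinaryAssignment (d : ℕ) (x : Sym2 (Fin d) → ℝ) : Prop :=
  ∀ i j : Fin d, i ≠ j → x s(i, j) = 0 ∨ x s(i, j) = 1

/-- The perfect-pairing constraint term `C(x) = ∑ i, (1 − ∑ j ≠ i, x {i,j})²`. -/
noncomputable def pairingConstraint (d : ℕ) (x : Sym2 (Fin d) → ℝ) : ℝ :=
  ∑ i : Fin d, (1 - ∑ j ∈ Finset.univ.filter (· ≠ i), x s(i, j)) ^ 2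

/-- The QUBO objective
`Q(x) = ∑_{i<j} W {i,j} * x {i,j} + P * ∑ i, (1 − ∑ j ≠ i, x {i,j})²`. -/
noncomputable def quboObjective (d : ℕ) (W : Sym2 (Fin d) → ℝ) (P : ℝ)
    (x : Sym2 (Fin d) → ℝ) : ℝ :=
  (∑ i : Fin d, ∑ j ∈ Finset.Ioi i, W s(i, j) * x s(i, j)) +
    P * pairingConstraint d x

/-- A perfect pairing of `Fin d`: a collection of unordered pairs of distinct
elements (2-element subsets) such that every element of `Fin d` lies in
exactly one pair. -/
def IsPerfectPairing (d : ℕ) (A : Finset (Sym2 (Fin d))) : Prop :=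
  (∀ e ∈ A, ¬ e.IsDiag) ∧ ∀ i : Fin d, ∃! e : Sym2 (Fin d), e ∈ A ∧ i ∈ e

open Classical in
/-- The set of non-diagonal pairs on which `x` takes the value `1`. -/
noncomputable def selectedPairs (d : ℕ) (x : Sym2 (Fin d) → ℝ) : Finset (Sym2 (Fin d)) :=
  Finset.univ.filter fun e => ¬ e.IsDiag ∧ x e = 1

lemma mem_selectedPairs {d : ℕ} {x : Sym2 (Fin d) → ℝ} {e : Sym2 (Fin d)} :
    e ∈ selectedPairs d x ↔ ¬ e.IsDiag ∧ x e = 1 := by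
  simp [selectedPairs]

lemma sum_Ioi_eq_sum_not_isDiag (d : ℕ) (f : Sym2 (Fin d) → ℝ) :
    ∑ i : Fin d, ∑ j ∈ Finset.Ioi i, f s(i, j) =
      ∑ e ∈ Finset.univ.filter (fun e : Sym2 (Fin d) => ¬ e.IsDiag), f e := by
  have h := Finset.sum_sym2_filter_not_isDiag (Finset.univ : Finset (Fin d)) f
  rw [Finset.sym2_univ] at h
  rw [h, Finset.sum_sigma']
  refine Finset.sum_bij' (fun a _ => (a.1, a.2)) (fun a _ => ⟨a.1, a.2⟩) ?_ ?_ ?_ ?_ ?_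
  · rintro ⟨i, j⟩ h
    simp only [Finset.mem_sigma, Finset.mem_univ, Finset.mem_Ioi, true_and] at h
    simp [h, h.ne]
  · rintro ⟨i, j⟩ h
    simp only [Finset.mem_filter] at h
    simp [h.2]
  all_goals simp

lemma nonneg_of_not_isDiag {d : ℕ} {W : Sym2 (Fin d) → ℝ}
    (hW : ∀ i j : Fin d, i ≠ j → 0 ≤ W s(i, j)) {e : Sym2 (Fin d)} (he : ¬ e.IsDiag) :
    0 ≤ W e := by
  induction e with
  | _ i j => exact hW i j (by simpa using he)

lemma IsBinaryAssignment.quboObjective_eq {d : ℕ} {x : Sym2 (Fin d) → ℝ}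
    (hx : IsBinaryAssignment d x) (W : Sym2 (Fin d) → ℝ) (P : ℝ) :
    quboObjective d W P x = ∑ e ∈ selectedPairs d x, W e + P * pairingConstraint d x := by
  classical
  have hs : selectedPairs d x =
      (Finset.univ.filter fun e : Sym2 (Fin d) => ¬ e.IsDiag).filter fun e => x e = 1 := by
    ext e
    simp [mem_selectedPairs]
  rw [quboObjective, sum_Ioi_eq_sum_not_isDiag d (fun e => W e * x e), hs,
    Finset.sum_filter (fun e => x e = 1)]
  congr 1
  refine Finset.sum_congr rfl fun e he => ?_
  induction e with
  | _ i j =>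
    rcases hx i j (by simpa using he) with h | h <;> simp [h]

lemma IsBinaryAssignment.sum_eq_card {d : ℕ} {x : Sym2 (Fin d) → ℝ}
    (hx : IsBinaryAssignment d x) (i : Fin d) :
    ∑ j ∈ Finset.univ.filter (· ≠ i), x s(i, j) =
      ((selectedPairs d x).filter (i ∈ ·)).card := by
  classical
  have hcard : ((selectedPairs d x).filter (i ∈ ·)).card =
      ((Finset.univ.filter (· ≠ i)).filter fun j => x s(i, j) = 1).card := by
    symm
    refine Finset.card_bij (fun j _ => s(i, j)) ?_ ?_ ?_
    · intro j hj
      simp only [Finset.mem_filter, Finset.mem_univ, true_and] at hj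
      simp [mem_selectedPairs, hj.2, hj.1.symm]
    · intro j _ k _ h
      exact Sym2.congr_right.mp h
    · intro e he
      obtain ⟨he, hi⟩ := Finset.mem_filter.mp he
      obtain ⟨hd, h1⟩ := mem_selectedPairs.mp he
      obtain ⟨j, rfl⟩ := Sym2.mem_iff_exists.mp hi
      refine ⟨j, ?_, rfl⟩
      simp only [Finset.mem_filter, Finset.mem_univ, true_and]
      exact ⟨fun h => hd (by simp [h]), h1⟩
  rw [hcard, Finset.card_filter, Nat.cast_sum]
  refine Finset.sum_congr rfl fun j hj => ?_
  rcases hx i j (by simpa using (Finset.mem_filter.mp hj).2.symm) with h | h <;> simp [h]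

lemma isPerfectPairing_selectedPairs_iff {d : ℕ} {x : Sym2 (Fin d) → ℝ} :
    IsPerfectPairing d (selectedPairs d x) ↔
      ∀ i : Fin d, ((selectedPairs d x).filter (i ∈ ·)).card = 1 := by
  have h (i : Fin d) : ((selectedPairs d x).filter (i ∈ ·)).card = 1 ↔
      ∃! e : Sym2 (Fin d), e ∈ selectedPairs d x ∧ i ∈ e := by
    simp only [Finset.card_eq_one, Finset.eq_singleton_iff_unique_mem, Finset.mem_filter,
      ExistsUnique]
  simp only [h, IsPerfectPairing, and_iff_right_iff_imp]
  exact fun _ e he => (mem_selectedPairs.mp he).1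

lemma IsBinaryAssignment.pairingConstraint_eq_zero {d : ℕ} {x : Sym2 (Fin d) → ℝ}
    (hx : IsBinaryAssignment d x) (h : IsPerfectPairing d (selectedPairs d x)) :
    pairingConstraint d x = 0 := by
  refine Finset.sum_eq_zero fun i _ => ?_
  rw [hx.sum_eq_card, isPerfectPairing_selectedPairs_iff.mp h i]
  simp

lemma IsBinaryAssignment.one_le_pairingConstraint {d : ℕ} {x : Sym2 (Fin d) → ℝ}
    (hx : IsBinaryAssignment d x) (h : ¬ IsPerfectPairing d (selectedPairs d x)) :
    1 ≤ pairingConstraint d x := by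
  rw [isPerfectPairing_selectedPairs_iff] at h
  push Not at h
  obtain ⟨i, hi⟩ := h
  refine le_trans ?_ (Finset.single_le_sum (fun i _ => sq_nonneg _) (Finset.mem_univ i))
  rw [hx.sum_eq_card]
  have hz : (1 : ℤ) - ((selectedPairs d x).filter (i ∈ ·)).card ≠ 0 := by omega
  have hsq : (1 : ℤ) ≤ (1 - ((selectedPairs d x).filter (i ∈ ·)).card : ℤ) ^ 2 := by
    have := sq_pos_of_ne_zero hz
    omega
  exact_mod_cast hsq

lemma IsPerfectPairing.exists_selectedPairs_eq {d : ℕ} {A : Finset (Sym2 (Fin d))}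
    (hA : IsPerfectPairing d A) :
    ∃ x : Sym2 (Fin d) → ℝ, IsBinaryAssignment d x ∧ selectedPairs d x = A := by
  classical
  refine ⟨fun e => if e ∈ A then 1 else 0, fun i j _ => ?_, ?_⟩
  · by_cases h : s(i, j) ∈ A <;> simp [h]
  · ext e
    simpa [mem_selectedPairs] using hA.1 e

lemma exists_isPerfectPairing {d : ℕ} (hd : Even d) : ∃ A, IsPerfectPairing d A := by
  classical
  have hne (i : Fin d) : i ≠ i.rev := by
    intro h
    have := congrArg Fin.val h
    rw [Fin.val_rev] at this
    obtain ⟨n, rfl⟩ := hd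
    omega
  refine ⟨Finset.univ.image fun i => s(i, i.rev), ?_, fun i => ⟨s(i, i.rev), by simp, ?_⟩⟩
  · intro e he
    obtain ⟨i, -, rfl⟩ := Finset.mem_image.mp he
    simpa using hne i
  · rintro e ⟨he, hi⟩
    obtain ⟨j, -, rfl⟩ := Finset.mem_image.mp he
    rcases Sym2.mem_iff.mp hi with rfl | rfl
    · rfl
    · rw [Fin.rev_rev, Sym2.eq_swap]

lemma IsPerfectPairing.sum_le {d : ℕ} {A : Finset (Sym2 (Fin d))} (hA : IsPerfectPairing d A)
    {W : Sym2 (Fin d) → ℝ} (hW : ∀ i j : Fin d, i ≠ j → 0 ≤ W s(i, j)) :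
    ∑ e ∈ A, W e ≤ ∑ i : Fin d, ∑ j ∈ Finset.Ioi i, W s(i, j) := by
  rw [sum_Ioi_eq_sum_not_isDiag]
  refine Finset.sum_le_sum_of_subset_of_nonneg (fun e he => by simpa using hA.1 e he) ?_
  intro e he _
  exact nonneg_of_not_isDiag hW (Finset.mem_filter.mp he).2

/-- Let `d` be even, `W` a nonnegative weight on unordered pairs of distinct
elements of `Fin d`, and `P > ∑_{i<j} W {i,j}`.  Then the minimum of the QUBO
objective over all binary assignments equals the minimum, over all perfect
pairings `A` of `Fin d`, of `∑_{{i,j} ∈ A} W {i,j}`. -/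
theorem qubo_min_eq_min_perfect_pairing
    (d : ℕ) (hd : Even d) (W : Sym2 (Fin d) → ℝ)
    (hW : ∀ i j : Fin d, i ≠ j → 0 ≤ W s(i, j)) (P : ℝ)
    (hP : (∑ i : Fin d, ∑ j ∈ Finset.Ioi i, W s(i, j)) < P) :
    sInf {q : ℝ | ∃ x : Sym2 (Fin d) → ℝ,
        IsBinaryAssignment d x ∧ q = quboObjective d W P x} =
      sInf {q : ℝ | ∃ A : Finset (Sym2 (Fin d)),
        IsPerfectPairing d A ∧ q = ∑ e ∈ A, W e} := by
  have hnonneg (A : Finset (Sym2 (Fin d))) (hA : ∀ e ∈ A, ¬ e.IsDiag) : 0 ≤ ∑ e ∈ A, W e :=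
    Finset.sum_nonneg fun e he => nonneg_of_not_isDiag hW (hA e he)
  obtain ⟨A₀, hA₀⟩ := exists_isPerfectPairing hd
  have hP₀ : ∑ e ∈ A₀, W e ≤ P := (hA₀.sum_le hW).trans hP.le
  have hsub : {q : ℝ | ∃ A, IsPerfectPairing d A ∧ q = ∑ e ∈ A, W e} ⊆
      {q : ℝ | ∃ x, IsBinaryAssignment d x ∧ q = quboObjective d W P x} := by
    rintro q ⟨A, hA, rfl⟩
    obtain ⟨x, hx, rfl⟩ := hA.exists_selectedPairs_eq
    exact ⟨x, hx, by rw [hx.quboObjective_eq, hx.pairingConstraint_eq_zero hA]; simp⟩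
  have hdom : ∀ q ∈ {q : ℝ | ∃ x, IsBinaryAssignment d x ∧ q = quboObjective d W P x},
      ∃ r ∈ {q : ℝ | ∃ A, IsPerfectPairing d A ∧ q = ∑ e ∈ A, W e}, r ≤ q := by
    rintro q ⟨x, hx, rfl⟩
    rw [hx.quboObjective_eq]
    by_cases h : IsPerfectPairing d (selectedPairs d x)
    · exact ⟨_, ⟨_, h, rfl⟩, by rw [hx.pairingConstraint_eq_zero h]; simp⟩
    · refine ⟨_, ⟨A₀, hA₀, rfl⟩, ?_⟩
      have h1 := hx.one_le_pairingConstraint h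
      have h2 := hnonneg (selectedPairs d x) fun e he => (mem_selectedPairs.mp he).1
      have h3 := hnonneg A₀ hA₀.1
      nlinarith
  have hbdd : BddBelow {q : ℝ | ∃ A, IsPerfectPairing d A ∧ q = ∑ e ∈ A, W e} :=
    ⟨0, by rintro q ⟨A, hA, rfl⟩; exact hnonneg A hA.1⟩
  have hne : {q : ℝ | ∃ A, IsPerfectPairing d A ∧ q = ∑ e ∈ A, W e}.Nonempty :=
    ⟨_, A₀, hA₀, rfl⟩
  refine le_antisymm (csInf_le_csInf ?_ hne hsub) (le_csInf (hne.mono hsub) fun q hq => ?_)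
  · obtain ⟨b, hb⟩ := hbdd
    refine ⟨b, fun q hq => ?_⟩
    obtain ⟨r, hr, hrq⟩ := hdom q hq
    exact (hb hr).trans hrq
  · obtain ⟨r, hr, hrq⟩ := hdom q hq
    exact (csInf_le hbdd hr).trans hrq
end

section
/- Let G be a finite connected simple graph with edge weights w : Sym2 V → ℝ satisfying w(e) ≥ 0 for every edge e, and let O be the set of vertices of G of odd degree. For every closed walk p in G whose edge list contains every edge of G, there exists a perfect pairing A of O such that the walk weight of p is at least Σ_{e ∈ E(G)} w(e) + Σ_{{u,v} ∈ A} dist_w(u,v). -/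
/-- The walk weight of a walk: the sum, over the edge list of the walk
(edges counted with multiplicity), of the weights of those edges. -/
def SimpleGraph.Walk.weight {V : Type*} {G : SimpleGraph V} (w : Sym2 V → ℝ)
    {u v : V} (p : G.Walk u v) : ℝ :=
  (p.edges.map w).sum

/-- The set of vertices of odd degree of a finite simple graph. -/
def SimpleGraph.oddDegreeVertices {V : Type*} [Fintype V] (G : SimpleGraph V)
    [DecidableRel G.Adj] : Finset V :=
  Finset.univ.filter fun v => Odd (G.degree v)

/-- A perfect pairing of a finite set `O`: a collection of unordered pairs of
distinct elements of `O` (2-element subsets of `O`) such that every element of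
`O` lies in exactly one pair. -/
def IsPerfectPairingOn {V : Type*} (O : Finset V) (A : Finset (Sym2 V)) : Prop :=
  (∀ e ∈ A, ¬ e.IsDiag ∧ ∀ v ∈ e, v ∈ O) ∧
    ∀ v ∈ O, ∃! e : Sym2 V, e ∈ A ∧ v ∈ e

/-- The shortest-path distance `dist_w` between the two endpoints of an
unordered pair `{u,v}`: the infimum of the walk weights over all walks in `G`
from `u` to `v`. -/
noncomputable def pairDist {V : Type*} (G : SimpleGraph V) (w : Sym2 V → ℝ)
    (e : Sym2 V) : ℝ :=
  sInf {r : ℝ | ∃ u v : V, e = s(u, v) ∧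
    ∃ p : G.Walk u v, r = SimpleGraph.Walk.weight w p}

namespace IsPerfectPairingOn

variable {V : Type*} {O : Finset V} {A : Finset (Sym2 V)} {a b : V}

lemma exists_mem (h : IsPerfectPairingOn O A) (ha : a ∈ O) :
    ∃ b ∈ O, a ≠ b ∧ s(a, b) ∈ A := by
  obtain ⟨e, ⟨heA, hae⟩, -⟩ := h.2 a ha
  obtain ⟨b, rfl⟩ := Sym2.mem_iff_exists.1 hae
  have := h.1 _ heA
  exact ⟨b, this.2 b (Sym2.mem_mk_right a b), by simpa using this.1, heA⟩

lemma erase [DecidableEq V] (h : IsPerfectPairingOn O A) (hab : s(a, b) ∈ A) :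
    IsPerfectPairingOn (O \ {a, b}) (A.erase s(a, b)) := by
  have hO := (h.1 _ hab).2
  refine ⟨fun e he => ?_, fun v hv => ?_⟩
  · rw [Finset.mem_erase] at he
    refine ⟨(h.1 e he.2).1, fun v hv => ?_⟩
    have hvO := (h.1 e he.2).2 v hv
    have hv' : v ∉ s(a, b) := fun hv' =>
      he.1 ((h.2 v hvO).unique ⟨he.2, hv⟩ ⟨hab, hv'⟩)
    simpa [hvO] using hv'
  · rw [Finset.mem_sdiff] at hv
    obtain ⟨e, ⟨heA, hve⟩, hu⟩ := h.2 v hv.1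
    refine ⟨e, ⟨Finset.mem_erase.2 ⟨?_, heA⟩, hve⟩, fun e' he' =>
      hu e' ⟨Finset.mem_of_mem_erase he'.1, he'.2⟩⟩
    rintro rfl
    exact hv.2 (by simpa using hve)

lemma notMem (h : IsPerfectPairingOn O A) (ha : a ∉ O) : s(a, b) ∉ A :=
  fun hab => ha ((h.1 _ hab).2 a (Sym2.mem_mk_left a b))

lemma insert [DecidableEq V] (h : IsPerfectPairingOn O A) (hne : a ≠ b) (ha : a ∉ O) (hb : b ∉ O) :
    IsPerfectPairingOn (O ∪ {a, b}) (insert s(a, b) A) := by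
  refine ⟨fun e he => ?_, fun v hv => ?_⟩
  · rcases Finset.mem_insert.1 he with rfl | he
    · simp [hne]
    · exact ⟨(h.1 e he).1, fun v hv => Finset.mem_union_left _ ((h.1 e he).2 v hv)⟩
  · by_cases hvO : v ∈ O
    · obtain ⟨e, ⟨heA, hve⟩, hu⟩ := h.2 v hvO
      refine ⟨e, ⟨Finset.mem_insert_of_mem heA, hve⟩, ?_⟩
      rintro e' ⟨he', hve'⟩
      rcases Finset.mem_insert.1 he' with rfl | he'
      · rcases Sym2.mem_iff.1 hve' with rfl | rfl <;> contradiction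
      · exact hu e' ⟨he', hve'⟩
    · refine ⟨s(a, b), ⟨Finset.mem_insert_self _ _, by simpa [hvO] using hv⟩, ?_⟩
      rintro e' ⟨he', hve'⟩
      rcases Finset.mem_insert.1 he' with rfl | he'
      · rfl
      · exact absurd ((h.1 e' he').2 v hve') hvO

end IsPerfectPairingOn

namespace SimpleGraph

variable {V : Type*} {G : SimpleGraph V} {w : Sym2 V → ℝ} {a b c : V}

namespace Walk

lemma weight_nonneg (hw : ∀ e ∈ G.edgeSet, 0 ≤ w e) (p : G.Walk a b) : 0 ≤ p.weight w :=
  List.sum_nonneg fun x hx => by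
    obtain ⟨e, he, rfl⟩ := List.mem_map.1 hx
    exact hw e (p.edges_subset_edgeSet he)

lemma weight_append (p : G.Walk a b) (q : G.Walk b c) :
    (p.append q).weight w = p.weight w + q.weight w := by
  simp [weight]

lemma weight_reverse (p : G.Walk a b) : p.reverse.weight w = p.weight w := by
  simp [weight, List.sum_reverse]

lemma even_countP_edges_iff [DecidableEq V] (p : G.Walk a b) (x : V) :
    Even (p.edges.countP fun e => x ∈ e) ↔ a ≠ b → x ≠ a ∧ x ≠ b := by
  induction p with
  | nil => simp
  | cons h p ih =>
    have := h.ne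
    rw [edges_cons, List.countP_cons]
    simp only [Sym2.mem_iff, decide_eq_true_eq]
    split_ifs <;> grind

end Walk

lemma pairDist_le (hw : ∀ e ∈ G.edgeSet, 0 ≤ w e) (p : G.Walk a b) :
    pairDist G w s(a, b) ≤ p.weight w := by
  refine csInf_le ⟨0, ?_⟩ ⟨a, b, rfl, p, rfl⟩
  rintro _ ⟨_, _, -, q, rfl⟩
  exact q.weight_nonneg hw

lemma pairDist_nonneg (hw : ∀ e ∈ G.edgeSet, 0 ≤ w e) (e : Sym2 V) : 0 ≤ pairDist G w e := by
  apply Real.sInf_nonneg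
  rintro _ ⟨_, _, -, q, rfl⟩
  exact q.weight_nonneg hw

lemma exists_walk_weight_lt (hG : G.Connected) {r : ℝ} (h : pairDist G w s(a, b) < r) :
    ∃ p : G.Walk a b, p.weight w < r := by
  obtain ⟨p₀⟩ := hG.preconnected a b
  obtain ⟨_, ⟨u, v, huv, p, rfl⟩, hp⟩ := exists_lt_of_csInf_lt
    (s := {r | ∃ u v, s(a, b) = s(u, v) ∧ ∃ p : G.Walk u v, r = p.weight w})
    ⟨_, a, b, rfl, p₀, rfl⟩ h
  rcases Sym2.eq_iff.1 huv with ⟨rfl, rfl⟩ | ⟨rfl, rfl⟩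
  · exact ⟨p, hp⟩
  · exact ⟨p.reverse, by rwa [Walk.weight_reverse]⟩

lemma pairDist_triangle (hG : G.Connected) (hw : ∀ e ∈ G.edgeSet, 0 ≤ w e) (a b c : V) :
    pairDist G w s(a, c) ≤ pairDist G w s(a, b) + pairDist G w s(b, c) := by
  refine le_of_forall_pos_lt_add fun ε hε => ?_
  obtain ⟨p, hp⟩ := exists_walk_weight_lt hG
    (lt_add_of_pos_right (pairDist G w s(a, b)) (half_pos hε))
  obtain ⟨q, hq⟩ := exists_walk_weight_lt hG
    (lt_add_of_pos_right (pairDist G w s(b, c)) (half_pos hε))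
  have := pairDist_le hw (p.append q)
  rw [Walk.weight_append] at this
  linarith

lemma pairDist_le_of_adj (hw : ∀ e ∈ G.edgeSet, 0 ≤ w e) (h : G.Adj a b) :
    pairDist G w s(a, b) ≤ w s(a, b) := by
  simpa [Walk.weight] using pairDist_le hw h.toWalk

lemma countP_mem_edgeFinset [Fintype V] [DecidableEq V] [DecidableRel G.Adj] (v : V) :
    G.edgeFinset.val.countP (v ∈ ·) = G.degree v := by
  rw [Multiset.countP_eq_card_filter, ← card_incidenceFinset_eq_degree,
    incidenceFinset_eq_filter]
  rfl

/-- A pairing of `O` can be changed into a pairing of the symmetric difference of `O` and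
`{a, b}` at a cost of at most the distance between `a` and `b`. -/
lemma exists_isPerfectPairingOn_symmDiff_pair [DecidableEq V] (hG : G.Connected)
    (hw : ∀ e ∈ G.edgeSet, 0 ≤ w e) {O : Finset V} {A : Finset (Sym2 V)}
    (hA : IsPerfectPairingOn O A) (hne : a ≠ b) :
    ∃ B : Finset (Sym2 V), IsPerfectPairingOn (symmDiff O {a, b}) B ∧
      ∑ e ∈ B, pairDist G w e ≤ pairDist G w s(a, b) + ∑ e ∈ A, pairDist G w e := by
  wlog hab : a ∈ O ∨ b ∉ O generalizing a b
  · rw [Sym2.eq_swap, Finset.pair_comm]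
    exact this hne.symm (by tauto)
  by_cases ha : a ∈ O
  · obtain ⟨c, hc, hac, hacA⟩ := hA.exists_mem ha
    have h₁ := hA.erase hacA
    have hs₁ := Finset.add_sum_erase A (pairDist G w) hacA
    have hca : pairDist G w s(c, a) = pairDist G w s(a, c) := by rw [Sym2.eq_swap]
    by_cases hb : b ∈ O
    · by_cases hbc : b = c
      · subst hbc
        have hO : O \ {a, b} = symmDiff O {a, b} := by
          ext v
          simp only [Finset.mem_symmDiff, Finset.mem_sdiff, Finset.mem_insert,
            Finset.mem_singleton]
          grind
        refine ⟨_, hO ▸ h₁, ?_⟩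
        have := pairDist_nonneg hw s(a, b)
        linarith
      · obtain ⟨d, hd, hbd, hbdA⟩ := h₁.exists_mem (a := b) (by grind)
        have h₂ := h₁.erase hbdA
        have h₃ := h₂.insert (a := c) (b := d) (by grind) (by grind) (by grind)
        have hO : (O \ {a, c}) \ {b, d} ∪ {c, d} = symmDiff O {a, b} := by
          ext v
          simp only [Finset.mem_symmDiff, Finset.mem_union, Finset.mem_sdiff,
            Finset.mem_insert, Finset.mem_singleton] at hd ⊢
          grind
        refine ⟨_, hO ▸ h₃, ?_⟩
        rw [Finset.sum_insert (h₂.notMem (by grind))]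
        have := Finset.add_sum_erase _ (pairDist G w) hbdA
        have := pairDist_triangle hG hw c a d
        have := pairDist_triangle hG hw a b d
        linarith
    · have h₂ := h₁.insert (a := c) (b := b) (by grind) (by grind) (by grind)
      have hO : O \ {a, c} ∪ {c, b} = symmDiff O {a, b} := by
        ext v
        simp only [Finset.mem_symmDiff, Finset.mem_union, Finset.mem_sdiff,
          Finset.mem_insert, Finset.mem_singleton]
        grind
      refine ⟨_, hO ▸ h₂, ?_⟩
      rw [Finset.sum_insert (h₁.notMem (by grind))]
      have := pairDist_triangle hG hw c a b
      linarith
  · have hb : b ∉ O := hab.resolve_left ha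
    have hO : O ∪ {a, b} = symmDiff O {a, b} := by
      ext v
      simp only [Finset.mem_symmDiff, Finset.mem_union, Finset.mem_insert,
        Finset.mem_singleton]
      grind
    exact ⟨_, hO ▸ hA.insert hne ha hb, (Finset.sum_insert (hA.notMem ha)).le⟩

/-- The vertices of odd degree in a multiset of edges can be paired up so that the total distance
within the pairs is at most the total weight of the edges. -/
lemma exists_isPerfectPairingOn_sum_pairDist_le [Fintype V] [DecidableEq V]
    (hG : G.Connected) (hw : ∀ e ∈ G.edgeSet, 0 ≤ w e) (M : Multiset (Sym2 V))
    (hM : ∀ e ∈ M, e ∈ G.edgeSet) :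
    ∃ A : Finset (Sym2 V),
      IsPerfectPairingOn (Finset.univ.filter fun v => Odd (M.countP (v ∈ ·))) A ∧
        ∑ e ∈ A, pairDist G w e ≤ (M.map w).sum := by
  induction M using Multiset.induction with
  | empty => exact ⟨∅, by simp [IsPerfectPairingOn]⟩
  | cons e M ih =>
    obtain ⟨A, hA, hle⟩ := ih fun e he => hM e (Multiset.mem_cons_of_mem he)
    induction e using Sym2.inductionOn with
    | _ a b =>
    have hadj : G.Adj a b := hM _ (Multiset.mem_cons_self _ _)
    obtain ⟨B, hB, hBle⟩ := exists_isPerfectPairingOn_symmDiff_pair hG hw hA hadj.ne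
    refine ⟨B, ?_, ?_⟩
    · convert hB using 1
      ext v
      simp only [Multiset.countP_cons, Finset.mem_symmDiff, Finset.mem_filter,
        Finset.mem_univ, true_and, Sym2.mem_iff, Finset.mem_insert, Finset.mem_singleton]
      split_ifs <;> grind
    · rw [Multiset.map_cons, Multiset.sum_cons]
      have := pairDist_le_of_adj hw hadj
      linarith

end SimpleGraph

/-- Let `G` be a finite connected simple graph with nonnegative edge weights
`w`, and let `O` be its set of odd-degree vertices.  For every closed walk `p`
in `G` whose edge list contains every edge of `G`, there exists a perfect
pairing `A` of `O` such that the walk weight of `p` is at least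
`∑ e ∈ E(G), w e + ∑ {u,v} ∈ A, dist_w u v`. -/
theorem postman_tour_gives_perfect_pairing
    {V : Type*} [Fintype V] [DecidableEq V]
    (G : SimpleGraph V) [DecidableRel G.Adj] (hG : G.Connected)
    (w : Sym2 V → ℝ) (hw : ∀ e ∈ G.edgeSet, 0 ≤ w e)
    (u : V) (p : G.Walk u u) (hcov : ∀ e ∈ G.edgeSet, e ∈ p.edges) :
    ∃ A : Finset (Sym2 V), IsPerfectPairingOn G.oddDegreeVertices A ∧
      ∑ e ∈ G.edgeFinset, w e + ∑ e ∈ A, pairDist G w e ≤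
        SimpleGraph.Walk.weight w p := by
  have hE : G.edgeFinset.val ≤ (p.edges : Multiset (Sym2 V)) :=
    (Multiset.le_iff_subset G.edgeFinset.nodup).2 fun e he =>
      hcov e (SimpleGraph.mem_edgeFinset.1 he)
  obtain ⟨M, hM⟩ := Multiset.le_iff_exists_add.1 hE
  obtain ⟨A, hA, hle⟩ := SimpleGraph.exists_isPerfectPairingOn_sum_pairDist_le hG hw M
    fun e he => p.edges_subset_edgeSet <| Multiset.mem_coe.1 <| by
      rw [hM]
      exact Multiset.mem_add.2 (Or.inr he)
  refine ⟨A, ?_, ?_⟩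
  · convert hA using 1
    refine Finset.filter_congr fun v _ => ?_
    have hp := (p.even_countP_edges_iff v).2 fun h => absurd rfl h
    rw [← Multiset.coe_countP, hM, Multiset.countP_add, SimpleGraph.countP_mem_edgeFinset] at hp
    grind
  · have hp : p.weight w = ((p.edges : Multiset (Sym2 V)).map w).sum := by
      simp [SimpleGraph.Walk.weight]
    rw [hp, hM, Multiset.map_add, Multiset.sum_add]
    exact add_le_add_right hle _
end
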